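/- Let {Vᵢ}ᵢ₌₁ⁿ be VLSMs over the same message set, each satisfying the channel authentication and sent-oracle assumptions, with a weight function from {1,…,n} to positive reals and a threshold t > 0. Let tr be a valid trace of the t-limited state-equivocation model V^{<t}_{s_eqv} with final state γ = ⟨γ₁,…,γₙ⟩, and let E = {i | len(γᵢ) > 1}. Then Σ_{i ∈ E} weight(i) < t and tr becomes, after replacing each component state γᵢ with i ∉ E by its unique entry γᵢ[1] and each label ⟨i, ⟨1, l⟩⟩ with i ∉ E by ⟨i, l⟩, a valid trace of the fixed-set state-equivocation model V^E_{s_eqv}. -/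

import Mathlib

set_option autoImplicit false

universe u v w

/-- A validating labelled state transition and message production system (VLSM):
labels, a nonempty set of initial states, initial messages, a total transition
function and a validity constraint.  `Option M` plays the role of `M ∪ {⊥}`. -/
structure VLSM (L : Type u) (S : Type v) (M : Type w) where
  init : Set S
  init_ne : init.Nonempty
  initMsg : Set M
  tau : L → S → Option M → S × Option M
  beta : L → S → Option M → Prop

/-- A transition record: label, source state, input message, target state, output message. -/
structure VTrans (L : Type u) (S : Type v) (M : Type w) where
  lbl : L
  src : S
  msg : Option M
  dst : S
  out : Option M

variable {L : Type u} {S : Type v} {M : Type w}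

/-- `Chain s tr sf`: the transitions of `tr` link up, starting at `s` and ending at `sf`. -/
def Chain : S → List (VTrans L S M) → S → Prop
  | s, [], sf => s = sf
  | s, t :: ts, sf => t.src = s ∧ Chain t.dst ts sf

namespace VLSM

/-- `t` is an actual transition of `V` (the transition function agrees with `t`). -/
def IsTrans (V : VLSM L S M) (t : VTrans L S M) : Prop :=
  V.tau t.lbl t.src t.msg = (t.dst, t.out)

/-- `t` is a constrained transition of `V`. -/
def IsConstrainedTrans (V : VLSM L S M) (t : VTrans L S M) : Prop :=
  V.IsTrans t ∧ V.beta t.lbl t.src t.msg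

/-- `tr` is a constrained trace of `V` reaching the state `sf`. -/
def ConstrainedTraceTo (V : VLSM L S M) (tr : List (VTrans L S M)) (sf : S) : Prop :=
  (∀ t ∈ tr, V.IsConstrainedTrans t) ∧ ∃ s0 ∈ V.init, Chain s0 tr sf

/-- A state is constrained if some constrained trace reaches it. -/
def ConstrainedState (V : VLSM L S M) (s : S) : Prop :=
  ∃ tr, V.ConstrainedTraceTo tr s

/-- Constrained reachability, defined inductively (a state is constrained iff it is
reachable from an initial state by constrained transitions). -/
inductive ReachState (V : VLSM L S M) : S → Prop where
  | init {s} : s ∈ V.init → ReachState V s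
  | step {l s m} : ReachState V s → V.beta l s m → ReachState V (V.tau l s m).1

mutual
  /-- Valid states of a VLSM. -/
  inductive ValidState (V : VLSM L S M) : S → Prop where
    | init {s} : s ∈ V.init → ValidState V s
    | step {l s m} : ValidState V s → ValidOMsg V m → V.beta l s m →
        ValidState V (V.tau l s m).1
  /-- Valid optional messages of a VLSM (`none` is always valid). -/
  inductive ValidOMsg (V : VLSM L S M) : Option M → Prop where
    | none : ValidOMsg V Option.none
    | init {m} : m ∈ V.initMsg → ValidOMsg V (some m)
    | step {l s m} : ValidState V s → ValidOMsg V m → V.beta l s m →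
        ValidOMsg V (V.tau l s m).2
end

/-- `t` is a valid transition of `V`. -/
def IsValidTrans (V : VLSM L S M) (t : VTrans L S M) : Prop :=
  V.IsConstrainedTrans t ∧ V.ValidState t.src ∧ V.ValidOMsg t.msg

/-- `tr` is a valid trace of `V` reaching the state `sf`. -/
def ValidTraceTo (V : VLSM L S M) (tr : List (VTrans L S M)) (sf : S) : Prop :=
  (∀ t ∈ tr, V.IsValidTrans t) ∧ ∃ s0 ∈ V.init, Chain s0 tr sf

/-- `tr` is a valid trace of `V`. -/
def IsValidTrace (V : VLSM L S M) (tr : List (VTrans L S M)) : Prop :=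
  ∃ sf, V.ValidTraceTo tr sf

end VLSM

/-- The message `m` is emitted (sent) on the trace `tr`. -/
def EmittedOn (tr : List (VTrans L S M)) (m : M) : Prop := ∃ t ∈ tr, t.out = some m

/-- The message `m` is received on the trace `tr`. -/
def ReceivedOn (tr : List (VTrans L S M)) (m : M) : Prop := ∃ t ∈ tr, t.msg = some m

/-- `sent` is a sent-oracle for `V`: at every constrained state `s`, `sent s m` holds
iff `m` is emitted on every constrained trace reaching `s`. -/
def IsSentOracle (V : VLSM L S M) (sent : S → M → Prop) : Prop :=
  ∀ s, V.ConstrainedState s → ∀ m,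
    (sent s m ↔ ∀ tr, V.ConstrainedTraceTo tr s → EmittedOn tr m)

/-- `recv` is a received-oracle for `V`. -/
def IsReceivedOracle (V : VLSM L S M) (recv : S → M → Prop) : Prop :=
  ∀ s, V.ConstrainedState s → ∀ m,
    (recv s m ↔ ∀ tr, V.ConstrainedTraceTo tr s → ReceivedOn tr m)

/-- The full node assumption: whenever receiving `m` is allowed by the validity
constraint, every direct dependency of `m` has been directly observed in the state. -/
def FullNodeAssumption (V : VLSM L S M) (dep : M → M → Prop)
    (sent recv : S → M → Prop) : Prop :=
  ∀ l s m, V.beta l s (some m) → ∀ m', dep m' m → sent s m' ∨ recv s m'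

section Composition

variable {ι : Type*} [DecidableEq ι] {Lf : ι → Type*} {Sf : ι → Type*}

/-- The constrained composition of an indexed family of VLSMs over the same
message set, under the composition constraint `φ`. -/
noncomputable def comp (V : ∀ i, VLSM (Lf i) (Sf i) M)
    (φ : (Σ i, Lf i) → (∀ i, Sf i) → Option M → Prop) :
    VLSM (Σ i, Lf i) (∀ i, Sf i) M where
  init := {σ | ∀ i, σ i ∈ (V i).init}
  init_ne := ⟨fun i => ((V i).init_ne).choose, fun i => ((V i).init_ne).choose_spec⟩
  initMsg := ⋃ i, (V i).initMsg
  tau := fun l σ m =>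
    (Function.update σ l.1 ((V l.1).tau l.2 (σ l.1) m).1, ((V l.1).tau l.2 (σ l.1) m).2)
  beta := fun l σ m => (V l.1).beta l.2 (σ l.1) m ∧ φ l σ m

/-- The free composition of an indexed family of VLSMs over the same message set. -/
noncomputable def freeComp (V : ∀ i, VLSM (Lf i) (Sf i) M) :
    VLSM (Σ i, Lf i) (∀ i, Sf i) M :=
  comp V fun _ _ _ => True

/-- Component `j` is a validator for the composite VLSM `W`: every constrained
transition from a constrained state of `V j` lifts to a valid transition of `W`
with matching `j`-th state components and matching input/output messages. -/
def IsValidatorAt (V : ∀ i, VLSM (Lf i) (Sf i) M)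
    (W : VLSM (Σ i, Lf i) (∀ i, Sf i) M) (j : ι) : Prop :=
  ∀ l s m, (V j).ConstrainedState s → (V j).beta l s m →
    ∃ σ : ∀ i, Sf i, σ j = s ∧
      W.IsValidTrans ⟨⟨j, l⟩, σ, m, (W.tau ⟨j, l⟩ σ m).1, (W.tau ⟨j, l⟩ σ m).2⟩ ∧
      (W.tau ⟨j, l⟩ σ m).1 j = ((V j).tau l s m).1 ∧
      (W.tau ⟨j, l⟩ σ m).2 = ((V j).tau l s m).2

/-- The induced `j`-th projection of a composite VLSM `W`: the same VLSM as the
component `Vj`, except that its initial messages are all valid messages of `W`. -/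
def projV {L' : Type*} {S' : Type*} {L2 : Type*} {S2 : Type*}
    (Vj : VLSM L' S' M) (W : VLSM L2 S2 M) : VLSM L' S' M :=
  { Vj with initMsg := {m | W.ValidOMsg (some m)} }

/-- The projection of a composite trace on component `j`. -/
def projTrace (j : ι) (tr : List (VTrans (Σ i, Lf i) (∀ i, Sf i) M)) :
    List (VTrans (Lf j) (Sf j) M) :=
  tr.filterMap fun t =>
    if h : t.lbl.1 = j then some ⟨h ▸ t.lbl.2, t.src j, t.msg, t.dst j, t.out⟩ else none

/-- The composition constraint of the fixed-set message-equivocation model: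
the only message-equivocations allowed are among the components of `E`. -/
def phiM (sender : M → ι) (sent : ∀ i, Sf i → M → Prop) (E : Set ι) :
    (Σ i, Lf i) → (∀ i, Sf i) → Option M → Prop :=
  fun l σ m => ∀ mm, m = some mm →
    (sent (sender mm) (σ (sender mm)) mm ∨ (l.1 ∈ E ∧ sender mm ∈ E))

end Composition

/-- Labels of the equivocating VLSM associated to a VLSM: act as the `i`-th copy,
duplicate the `i`-th copy, or spawn a new machine after position `i` (1-based). -/
inductive ELabel (L : Type u) (S : Type v) where
  | act (i : ℕ) (l : L)
  | dup (i : ℕ)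
  | new (i : ℕ) (s : S)

/-- The equivocating VLSM associated to a VLSM `V`: its states are (nonempty) lists
of states of `V`, and it can fork itself or spawn fresh copies at any moment. -/
noncomputable def eVLSM (V : VLSM L S M) : VLSM (ELabel L S) (List S) M where
  init := {γ | ∃ s ∈ V.init, γ = [s]}
  init_ne := ⟨[V.init_ne.choose], V.init_ne.choose, V.init_ne.choose_spec, rfl⟩
  initMsg := V.initMsg
  tau := fun lab γ m =>
    match lab with
    | .act i l =>
      match γ[i - 1]? with
      | some s => (γ.set (i - 1) (V.tau l s m).1, (V.tau l s m).2)
      | none => (γ, Option.none)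
    | .dup i =>
      match γ[i - 1]? with
      | some s => (γ.take i ++ s :: γ.drop i, Option.none)
      | none => (γ, Option.none)
    | .new i s0 => (γ.take i ++ s0 :: γ.drop i, Option.none)
  beta := fun lab γ m =>
    match lab with
    | .act i l => 1 ≤ i ∧ i ≤ γ.length ∧ ∃ s, γ[i - 1]? = some s ∧ V.beta l s m
    | .dup i => 1 ≤ i ∧ i ≤ γ.length ∧ m = Option.none
    | .new i s0 => 1 ≤ i ∧ i ≤ γ.length ∧ m = Option.none ∧ s0 ∈ V.init

section FixedSetEquivocation

variable {n : ℕ} {Lf Sf : Fin n → Type} {M : Type}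

/-- State type of the `i`-th component in the fixed-set state-equivocation model:
the equivocating version (lists of states) for `i ∈ E`, the original state type
otherwise. -/
def mixS (E : Finset (Fin n)) (Sf : Fin n → Type) (i : Fin n) : Type :=
  if i ∈ E then List (Sf i) else Sf i

/-- Label type of the `i`-th component in the fixed-set state-equivocation model. -/
def mixL (E : Finset (Fin n)) (Lf Sf : Fin n → Type) (i : Fin n) : Type :=
  if i ∈ E then ELabel (Lf i) (Sf i) else Lf i

def toListE (E : Finset (Fin n)) {i : Fin n} (h : i ∈ E) (x : mixS E Sf i) :
    List (Sf i) :=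
  cast (by simp only [mixS, if_pos h]) x

def toPlainE (E : Finset (Fin n)) {i : Fin n} (h : i ∉ E) (x : mixS E Sf i) : Sf i :=
  cast (by simp only [mixS, if_neg h]) x

def toELbl (E : Finset (Fin n)) {i : Fin n} (h : i ∈ E) (l : mixL E Lf Sf i) :
    ELabel (Lf i) (Sf i) :=
  cast (by simp only [mixL, if_pos h]) l

def toPlainLbl (E : Finset (Fin n)) {i : Fin n} (h : i ∉ E) (l : mixL E Lf Sf i) :
    Lf i :=
  cast (by simp only [mixL, if_neg h]) l

/-- The family of components of the fixed-set state-equivocation model: the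
components of `E` are replaced by their equivocating versions. -/
noncomputable def mixV (E : Finset (Fin n)) (V : ∀ i, VLSM (Lf i) (Sf i) M)
    (i : Fin n) : VLSM (mixL E Lf Sf i) (mixS E Sf i) M := by
  unfold mixL mixS
  by_cases h : i ∈ E
  · simp only [if_pos h]; exact eVLSM (V i)
  · simp only [if_neg h]; exact V i

/-- The sent oracle lifted to the components of the fixed-set state-equivocation
model (`sent^e` on equivocating components). -/
def sentMix (E : Finset (Fin n)) (sent : ∀ i, Sf i → M → Prop)
    (i : Fin n) (x : mixS E Sf i) (m : M) : Prop :=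
  if h : i ∈ E then ∃ s ∈ toListE E h x, sent i s m
  else sent i (toPlainE E h x) m

/-- The composition constraint `φ_{s_eqv}` of the fixed-set state-equivocation model:
components may only receive messages sent in the current trace. -/
def phiS (E : Finset (Fin n)) (sender : M → Fin n) (sent : ∀ i, Sf i → M → Prop) :
    (Σ i, mixL E Lf Sf i) → (∀ i, mixS E Sf i) → Option M → Prop :=
  fun _ γ m => ∀ mm, m = some mm → sentMix E sent (sender mm) (γ (sender mm)) mm

/-- The fixed-set state-equivocation model `V^E_{s_eqv}`. -/
noncomputable def VsE (E : Finset (Fin n)) (V : ∀ i, VLSM (Lf i) (Sf i) M)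
    (sender : M → Fin n) (sent : ∀ i, Sf i → M → Prop) :
    VLSM (Σ i, mixL E Lf Sf i) (∀ i, mixS E Sf i) M :=
  comp (mixV E V) (phiS E sender sent)

/-- The state reduct of a state of the fixed-set state-equivocation model:
the first list entry for equivocating components. -/
noncomputable def reductS (E : Finset (Fin n)) (V : ∀ i, VLSM (Lf i) (Sf i) M)
    (γ : ∀ i, mixS E Sf i) : ∀ i, Sf i :=
  fun i =>
    if h : i ∈ E then (toListE E h (γ i)).headD (V i).init_ne.choose
    else toPlainE E h (γ i)

/-- The transition reduct: transitions on the first copy of an equivocating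
component (or on a non-equivocating component) reduce to transitions of the
composition of the original components; all others are dropped. -/
noncomputable def transReduct (E : Finset (Fin n)) (V : ∀ i, VLSM (Lf i) (Sf i) M)
    (t : VTrans (Σ i, mixL E Lf Sf i) (∀ i, mixS E Sf i) M) :
    Option (VTrans (Σ i, Lf i) (∀ i, Sf i) M) :=
  if h : t.lbl.1 ∈ E then
    match toELbl E h t.lbl.2 with
    | .act 1 l => some ⟨⟨t.lbl.1, l⟩, reductS E V t.src, t.msg, reductS E V t.dst, t.out⟩
    | _ => none
  else
    some ⟨⟨t.lbl.1, toPlainLbl E h t.lbl.2⟩,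
      reductS E V t.src, t.msg, reductS E V t.dst, t.out⟩

/-- The trace reduct of a trace of the fixed-set state-equivocation model. -/
noncomputable def traceReduct (E : Finset (Fin n)) (V : ∀ i, VLSM (Lf i) (Sf i) M)
    (tr : List (VTrans (Σ i, mixL E Lf Sf i) (∀ i, mixS E Sf i) M)) :
    List (VTrans (Σ i, Lf i) (∀ i, Sf i) M) :=
  tr.filterMap (transReduct E V)

/-- The fixed-set message-equivocation model `V^E_{m_eqv}`. -/
noncomputable def VmE (E : Finset (Fin n)) (V : ∀ i, VLSM (Lf i) (Sf i) M)
    (sender : M → Fin n) (sent : ∀ i, Sf i → M → Prop) :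
    VLSM (Σ i, Lf i) (∀ i, Sf i) M :=
  comp V (phiM sender sent ↑E)

end FixedSetEquivocation

section LimitedEquivocation

variable {n : ℕ} {Lf Sf : Fin n → Type} {M : Type}

/-- The composition constraint `φ^{<t}_{s_eqv}` of the t-limited state-equivocation
model: messages must have been sent in the current trace, and the total weight of
the components whose list of copies has more than one entry after the transition
stays below the threshold. -/
noncomputable def phiSlim (V : ∀ i, VLSM (Lf i) (Sf i) M) (sender : M → Fin n)
    (sent : ∀ i, Sf i → M → Prop) (w : Fin n → ℝ) (t : ℝ) :
    (Σ i, ELabel (Lf i) (Sf i)) → (∀ i, List (Sf i)) → Option M → Prop :=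
  fun l γ m =>
    (∀ mm, m = some mm → ∃ s ∈ γ (sender mm), sent (sender mm) s mm) ∧
    (∑ k ∈ Finset.univ.filter fun k : Fin n =>
        1 < (Function.update γ l.1 ((eVLSM (V l.1)).tau l.2 (γ l.1) m).1 k).length,
      w k) < t

/-- The t-limited state-equivocation model `V^{<t}_{s_eqv}`: every component is
replaced by its equivocating version. -/
noncomputable def Vslim (V : ∀ i, VLSM (Lf i) (Sf i) M) (sender : M → Fin n)
    (sent : ∀ i, Sf i → M → Prop) (w : Fin n → ℝ) (t : ℝ) :
    VLSM (Σ i, ELabel (Lf i) (Sf i)) (∀ i, List (Sf i)) M :=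
  comp (fun i => eVLSM (V i)) (phiSlim V sender sent w t)

/-- The state reduct for the t-limited state-equivocation model: the first list
entry of each component. -/
noncomputable def reductLim (V : ∀ i, VLSM (Lf i) (Sf i) M)
    (γ : ∀ i, List (Sf i)) : ∀ i, Sf i :=
  fun i => (γ i).headD (V i).init_ne.choose

/-- The transition reduct for the t-limited state-equivocation model. -/
noncomputable def transReductLim (V : ∀ i, VLSM (Lf i) (Sf i) M)
    (t : VTrans (Σ i, ELabel (Lf i) (Sf i)) (∀ i, List (Sf i)) M) :
    Option (VTrans (Σ i, Lf i) (∀ i, Sf i) M) :=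
  match t.lbl.2 with
  | .act 1 l => some ⟨⟨t.lbl.1, l⟩, reductLim V t.src, t.msg, reductLim V t.dst, t.out⟩
  | _ => none

/-- The trace reduct for the t-limited state-equivocation model. -/
noncomputable def traceReductLim (V : ∀ i, VLSM (Lf i) (Sf i) M)
    (tr : List (VTrans (Σ i, ELabel (Lf i) (Sf i)) (∀ i, List (Sf i)) M)) :
    List (VTrans (Σ i, Lf i) (∀ i, Sf i) M) :=
  tr.filterMap (transReductLim V)

open scoped Classical in
/-- Updating the set of equivocators on a transition: the sender of the received
message is added if the message has not been sent in the current composite state. -/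
noncomputable def updEqv (sender : M → Fin n) (sent : ∀ i, Sf i → M → Prop)
    (σ : ∀ i, Sf i) (m : Option M) (eqv : Finset (Fin n)) : Finset (Fin n) :=
  match m with
  | Option.none => eqv
  | some mm => if ∃ i, sent i (σ i) mm then eqv else insert (sender mm) eqv

/-- The t-limited message-equivocation model `V^{<t}_{m_eqv}`: the free composition
annotated with the set of equivocators observed in the current trace, constrained
so that the total weight of equivocators stays below the threshold. -/
noncomputable def annV (V : ∀ i, VLSM (Lf i) (Sf i) M) (sender : M → Fin n)
    (sent : ∀ i, Sf i → M → Prop) (w : Fin n → ℝ) (t : ℝ) :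
    VLSM (Σ i, Lf i) ((∀ i, Sf i) × Finset (Fin n)) M where
  init := {p | (∀ i, p.1 i ∈ (V i).init) ∧ p.2 = ∅}
  init_ne :=
    ⟨⟨fun i => ((V i).init_ne).choose, ∅⟩, fun i => ((V i).init_ne).choose_spec, rfl⟩
  initMsg := ⋃ i, (V i).initMsg
  tau := fun l p m =>
    ((Function.update p.1 l.1 ((V l.1).tau l.2 (p.1 l.1) m).1,
      updEqv sender sent p.1 m p.2),
     ((V l.1).tau l.2 (p.1 l.1) m).2)
  beta := fun l p m =>
    (V l.1).beta l.2 (p.1 l.1) m ∧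
      (∑ j ∈ updEqv sender sent p.1 m p.2, w j) < t

/-- Annotating a trace of the free composition with the accumulated sets of
equivocators, starting from the given set. -/
noncomputable def annotate (sender : M → Fin n) (sent : ∀ i, Sf i → M → Prop) :
    Finset (Fin n) → List (VTrans (Σ i, Lf i) (∀ i, Sf i) M) →
      List (VTrans (Σ i, Lf i) ((∀ i, Sf i) × Finset (Fin n)) M)
  | _, [] => []
  | eqv, t :: ts =>
      ⟨t.lbl, (t.src, eqv), t.msg, (t.dst, updEqv sender sent t.src t.msg eqv), t.out⟩ ::
        annotate sender sent (updEqv sender sent t.src t.msg eqv) ts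

/-- Forgetting the equivocator annotations of a transition. -/
def stripAnn (t : VTrans (Σ i, Lf i) ((∀ i, Sf i) × Finset (Fin n)) M) :
    VTrans (Σ i, Lf i) (∀ i, Sf i) M :=
  ⟨t.lbl, t.src.1, t.msg, t.dst.1, t.out⟩

end LimitedEquivocation

section Embedding

variable {n : ℕ} {Lf Sf : Fin n → Type} {M : Type}

/-- Embedding the states of the fixed-set state-equivocation model into the
all-equivocator states: regular component states become singleton lists. -/
noncomputable def embedS (E : Finset (Fin n)) (γ : ∀ i, mixS E Sf i) :
    ∀ i, List (Sf i) :=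
  fun i => if h : i ∈ E then toListE E h (γ i) else [toPlainE E h (γ i)]

/-- Embedding the labels of the fixed-set state-equivocation model: labels of
regular components act on the first (unique) copy. -/
noncomputable def embedL (E : Finset (Fin n)) (l : Σ i, mixL E Lf Sf i) :
    Σ i, ELabel (Lf i) (Sf i) :=
  if h : l.1 ∈ E then ⟨l.1, toELbl E h l.2⟩
  else ⟨l.1, .act 1 (toPlainLbl E h l.2)⟩

/-- Embedding transitions of the fixed-set state-equivocation model into the
t-limited state-equivocation model. -/
noncomputable def embedT (E : Finset (Fin n))
    (t : VTrans (Σ i, mixL E Lf Sf i) (∀ i, mixS E Sf i) M) :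
    VTrans (Σ i, ELabel (Lf i) (Sf i)) (∀ i, List (Sf i)) M :=
  ⟨embedL E t.lbl, embedS E t.src, t.msg, embedS E t.dst, t.out⟩

/-- Mapping all-equivocator states back to states of the fixed-set
state-equivocation model: components outside `E` are replaced by their unique
(first) entry. -/
noncomputable def unembedS (E : Finset (Fin n)) (V : ∀ i, VLSM (Lf i) (Sf i) M)
    (γ : ∀ i, List (Sf i)) : ∀ i, mixS E Sf i :=
  fun i =>
    if h : i ∈ E then
      cast (show List (Sf i) = mixS E Sf i by simp only [mixS, if_pos h]) (γ i)
    else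
      cast (show Sf i = mixS E Sf i by simp only [mixS, if_neg h])
        ((γ i).headD (V i).init_ne.choose)

/-- Mapping all-equivocator labels back to labels of the fixed-set
state-equivocation model: labels `⟨i, ⟨1, l⟩⟩` with `i ∉ E` become `⟨i, l⟩`. -/
noncomputable def unembedL (E : Finset (Fin n)) (l : Σ i, ELabel (Lf i) (Sf i)) :
    Option (Σ i, mixL E Lf Sf i) :=
  if h : l.1 ∈ E then
    some ⟨l.1,
      cast (show ELabel (Lf l.1) (Sf l.1) = mixL E Lf Sf l.1 by
        simp only [mixL, if_pos h]) l.2⟩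
  else
    match l.2 with
    | .act 1 ll =>
        some ⟨l.1,
          cast (show Lf l.1 = mixL E Lf Sf l.1 by simp only [mixL, if_neg h]) ll⟩
    | _ => none

/-- Mapping all-equivocator transitions back to transitions of the fixed-set
state-equivocation model. -/
noncomputable def unembedT (E : Finset (Fin n)) (V : ∀ i, VLSM (Lf i) (Sf i) M)
    (t : VTrans (Σ i, ELabel (Lf i) (Sf i)) (∀ i, List (Sf i)) M) :
    Option (VTrans (Σ i, mixL E Lf Sf i) (∀ i, mixS E Sf i) M) :=
  (unembedL E t.lbl).map fun l =>
    ⟨l, unembedS E V t.src, t.msg, unembedS E V t.dst, t.out⟩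

end Embedding

theorem chain_append_singleton {L S M : Type*} (tr : List (VTrans L S M)) (t : VTrans L S M)
    (s sf : S) : Chain s (tr ++ [t]) sf ↔ Chain s tr t.src ∧ t.dst = sf := by
  induction tr generalizing s with
  | nil => simp [Chain, eq_comm]
  | cons a tr ih => simp [Chain, ih, and_assoc]

namespace VLSM

theorem validTraceTo_append_singleton {L S M : Type*} (V : VLSM L S M)
    (tr : List (VTrans L S M)) (t : VTrans L S M) (sf : S) :
    V.ValidTraceTo (tr ++ [t]) sf ↔
      V.ValidTraceTo tr t.src ∧ V.IsValidTrans t ∧ t.dst = sf := by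
  simp only [ValidTraceTo, chain_append_singleton, List.mem_append, List.mem_singleton, or_imp,
    forall_and, forall_eq]
  grind

theorem ConstrainedTraceTo.append_singleton {L S M : Type*} {V : VLSM L S M}
    {tr : List (VTrans L S M)} {s : S} (h : V.ConstrainedTraceTo tr s) {l : L} {m : Option M}
    (hb : V.beta l s m) :
    V.ConstrainedTraceTo (tr ++ [⟨l, s, m, (V.tau l s m).1, (V.tau l s m).2⟩])
      (V.tau l s m).1 := by
  obtain ⟨h1, s0, h0, hc⟩ := h
  refine ⟨?_, s0, h0, (chain_append_singleton _ _ _ _).2 ⟨hc, rfl⟩⟩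
  simp only [List.mem_append, List.mem_singleton]
  rintro x (hx | rfl)
  · exact h1 x hx
  · exact ⟨rfl, hb⟩

theorem IsValidTrans.validState_dst {L S M : Type*} {V : VLSM L S M} {t : VTrans L S M}
    (h : V.IsValidTrans t) : V.ValidState t.dst := by
  obtain ⟨⟨h1, h2⟩, h3, h4⟩ := h
  have := ValidState.step h3 h4 h2
  rwa [h1] at this

theorem IsValidTrans.validOMsg_out {L S M : Type*} {V : VLSM L S M} {t : VTrans L S M}
    (h : V.IsValidTrans t) : V.ValidOMsg t.out := by
  obtain ⟨⟨h1, h2⟩, h3, h4⟩ := h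
  have := ValidOMsg.step h3 h4 h2
  rwa [h1] at this

theorem ValidTraceTo.validState {L S M : Type*} {V : VLSM L S M} {tr : List (VTrans L S M)}
    {s : S} (h : V.ValidTraceTo tr s) : V.ValidState s := by
  induction tr using List.reverseRecOn with
  | nil =>
    obtain ⟨-, s0, h0, rfl⟩ := h
    exact .init h0
  | append_singleton tr t _ =>
    obtain ⟨-, ht, rfl⟩ := (validTraceTo_append_singleton _ _ _ _).1 h
    exact ht.validState_dst

theorem tau_cast_of_heq {L L' S S' M : Type} (hL : L = L') (hS : S = S') {W : VLSM L S M}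
    {W' : VLSM L' S' M} (h : HEq W W') (l : L') (s : S') (m : Option M) :
    W.tau (cast hL.symm l) (cast hS.symm s) m =
      (cast hS.symm (W'.tau l s m).1, (W'.tau l s m).2) := by
  subst hL hS
  cases h
  rfl

theorem beta_cast_of_heq {L L' S S' M : Type} (hL : L = L') (hS : S = S') {W : VLSM L S M}
    {W' : VLSM L' S' M} (h : HEq W W') (l : L') (s : S') (m : Option M) :
    W.beta (cast hL.symm l) (cast hS.symm s) m ↔ W'.beta l s m := by
  subst hL hS
  cases h
  rfl

theorem cast_mem_init_of_heq {L L' S S' M : Type} (hL : L = L') (hS : S = S') {W : VLSM L S M}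
    {W' : VLSM L' S' M} (h : HEq W W') (s : S') :
    cast hS.symm s ∈ W.init ↔ s ∈ W'.init := by
  subst hL hS
  cases h
  rfl

end VLSM

section EquivocatorVLSM

variable {L S M : Type}

theorem eVLSM_tau_length_le (V : VLSM L S M) (l : ELabel L S) (γ : List S) (m : Option M) :
    γ.length ≤ ((eVLSM V).tau l γ m).1.length := by
  cases l <;> simp only [eVLSM] <;> (try split) <;> simp <;> omega

/-- A transition of an equivocator that leaves at most one copy is a transition of the
original machine on its unique copy. -/
theorem eVLSM_act_of_length_le_one (V : VLSM L S M) {l : ELabel L S} {γ : List S}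
    {m : Option M} (hb : (eVLSM V).beta l γ m)
    (hl : ((eVLSM V).tau l γ m).1.length ≤ 1) :
    ∃ l' s, l = .act 1 l' ∧ γ = [s] ∧ V.beta l' s m ∧
      (eVLSM V).tau l γ m = ([(V.tau l' s m).1], (V.tau l' s m).2) := by
  cases l with
  | act i l' =>
    have hγ := (eVLSM_tau_length_le V _ γ m).trans hl
    obtain ⟨h1, h2, s, hs, hb⟩ := hb
    obtain rfl : i = 1 := by omega
    obtain ⟨a, rfl⟩ := List.length_eq_one_iff.1 (le_antisymm hγ h2)
    simp only [Nat.sub_self, List.getElem?_cons_zero, Option.some.injEq] at hs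
    subst hs
    exact ⟨l', a, rfl, rfl, hb, rfl⟩
  | dup i =>
    obtain ⟨h1, h2, -⟩ := hb
    have hi : γ[i - 1]? = some γ[i - 1] := List.getElem?_eq_getElem (by omega)
    simp [eVLSM, hi] at hl
    omega
  | new i s =>
    obtain ⟨h1, h2, -⟩ := hb
    simp [eVLSM] at hl
    omega

/-- Every copy after a transition of an equivocator is a copy from before, a fresh copy, or
the result of a transition of an old copy with the same messages. -/
theorem eVLSM_mem_tau (V : VLSM L S M) {l : ELabel L S} {γ : List S} {m : Option M}
    (hb : (eVLSM V).beta l γ m) {s : S} (hs : s ∈ ((eVLSM V).tau l γ m).1) :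
    s ∈ γ ∨ s ∈ V.init ∨ ∃ l', ∃ s' ∈ γ, V.beta l' s' m ∧ s = (V.tau l' s' m).1 ∧
      ((eVLSM V).tau l γ m).2 = (V.tau l' s' m).2 := by
  cases l with
  | act i l' =>
    obtain ⟨h1, h2, a, ha, hb⟩ := hb
    simp only [eVLSM, ha] at hs ⊢
    rcases List.mem_or_eq_of_mem_set hs with hs | rfl
    · exact .inl hs
    · exact .inr (.inr ⟨l', a, List.mem_of_getElem? ha, hb, rfl, rfl⟩)
  | dup i =>
    obtain ⟨h1, h2, -⟩ := hb
    have hi : γ[i - 1]? = some γ[i - 1] := List.getElem?_eq_getElem (by omega)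
    simp only [eVLSM, hi, List.mem_append, List.mem_cons] at hs
    rcases hs with hs | rfl | hs
    · exact .inl (List.mem_of_mem_take hs)
    · exact .inl (List.getElem_mem _)
    · exact .inl (List.mem_of_mem_drop hs)
  | new i s0 =>
    obtain ⟨h1, h2, -, h0⟩ := hb
    simp only [eVLSM, List.mem_append, List.mem_cons] at hs
    rcases hs with hs | rfl | hs
    · exact .inl (List.mem_of_mem_take hs)
    · exact .inr (.inl h0)
    · exact .inl (List.mem_of_mem_drop hs)

end EquivocatorVLSM

section FixedSetModel

variable {n : ℕ} {Lf Sf : Fin n → Type} {M : Type}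

theorem mixS_of_mem {E : Finset (Fin n)} {i : Fin n} (h : i ∈ E) :
    mixS E Sf i = List (Sf i) := by
  simp only [mixS, if_pos h]

theorem mixS_of_notMem {E : Finset (Fin n)} {i : Fin n} (h : i ∉ E) :
    mixS E Sf i = Sf i := by
  simp only [mixS, if_neg h]

theorem mixL_of_mem {E : Finset (Fin n)} {i : Fin n} (h : i ∈ E) :
    mixL E Lf Sf i = ELabel (Lf i) (Sf i) := by
  simp only [mixL, if_pos h]

theorem mixL_of_notMem {E : Finset (Fin n)} {i : Fin n} (h : i ∉ E) :
    mixL E Lf Sf i = Lf i := by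
  simp only [mixL, if_neg h]

theorem mixV_heq_of_mem {E : Finset (Fin n)} (V : ∀ i, VLSM (Lf i) (Sf i) M) {i : Fin n}
    (h : i ∈ E) : HEq (mixV E V i) (eVLSM (V i)) := by
  simp only [mixV, id, h, reduceDIte, eq_mpr_eq_cast]
  exact cast_heq _ _

theorem mixV_heq_of_notMem {E : Finset (Fin n)} (V : ∀ i, VLSM (Lf i) (Sf i) M) {i : Fin n}
    (h : i ∉ E) : HEq (mixV E V i) (V i) := by
  simp only [mixV, id, h, reduceDIte, eq_mpr_eq_cast]
  exact cast_heq _ _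

theorem unembedS_of_mem {E : Finset (Fin n)} (V : ∀ i, VLSM (Lf i) (Sf i) M)
    (γ : ∀ i, List (Sf i)) {i : Fin n} (h : i ∈ E) :
    unembedS E V γ i = cast (mixS_of_mem h).symm (γ i) :=
  dif_pos h

theorem unembedS_of_notMem {E : Finset (Fin n)} (V : ∀ i, VLSM (Lf i) (Sf i) M)
    (γ : ∀ i, List (Sf i)) {i : Fin n} (h : i ∉ E) :
    unembedS E V γ i =
      cast (mixS_of_notMem h).symm ((γ i).headD (V i).init_ne.choose) :=
  dif_neg h

theorem unembedS_update {E : Finset (Fin n)} (V : ∀ i, VLSM (Lf i) (Sf i) M)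
    (γ : ∀ i, List (Sf i)) (i : Fin n) (x : List (Sf i)) :
    unembedS E V (Function.update γ i x) =
      Function.update (unembedS E V γ) i (unembedS E V (Function.update γ i x) i) := by
  funext j
  by_cases h : j = i
  · subst h; simp
  · simp [unembedS, h]

theorem sentMix_unembedS {E : Finset (Fin n)} (V : ∀ i, VLSM (Lf i) (Sf i) M)
    (sent : ∀ i, Sf i → M → Prop) {γ : ∀ i, List (Sf i)} {i : Fin n}
    (hi : i ∉ E → (γ i).length ≤ 1) {m : M} (hs : ∃ s ∈ γ i, sent i s m) :
    sentMix E sent i (unembedS E V γ i) m := by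
  by_cases h : i ∈ E
  · simpa [sentMix, h, unembedS_of_mem, toListE] using hs
  · obtain ⟨s, hs, hm⟩ := hs
    have : γ i = [s] := by
      obtain ⟨a, ha⟩ := List.length_eq_one_iff.1
        (le_antisymm (hi h) (List.length_pos_of_mem hs))
      simp_all
    simpa [sentMix, h, unembedS_of_notMem, toPlainE, this] using hm

theorem unembedS_mem_init {E : Finset (Fin n)} (V : ∀ i, VLSM (Lf i) (Sf i) M)
    (sender : M → Fin n) (sent : ∀ i, Sf i → M → Prop) {γ : ∀ i, List (Sf i)}
    (hγ : ∀ i, γ i ∈ (eVLSM (V i)).init) :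
    unembedS E V γ ∈ (VsE E V sender sent).init := by
  intro i
  by_cases h : i ∈ E
  · rw [unembedS_of_mem V γ h]
    exact (VLSM.cast_mem_init_of_heq (mixL_of_mem h) (mixS_of_mem h)
      (mixV_heq_of_mem V h) _).2 (hγ i)
  · rw [unembedS_of_notMem V γ h]
    obtain ⟨s, hs, he⟩ := hγ i
    refine (VLSM.cast_mem_init_of_heq (mixL_of_notMem h) (mixS_of_notMem h)
      (mixV_heq_of_notMem V h) _).2 ?_
    rwa [he]

/-- A transition of the composition of equivocators that leaves at most one copy of each
component outside `E` maps to a constrained transition of the fixed-set model. -/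
theorem exists_unembedT_eq_some {E : Finset (Fin n)} (V : ∀ i, VLSM (Lf i) (Sf i) M)
    (sender : M → Fin n) (sent : ∀ i, Sf i → M → Prop)
    {t : VTrans (Σ i, ELabel (Lf i) (Sf i)) (∀ i, List (Sf i)) M}
    (ht : (freeComp fun i => eVLSM (V i)).IsConstrainedTrans t)
    (hsent : ∀ m, t.msg = some m → ∃ s ∈ t.src (sender m), sent (sender m) s m)
    (hsrc : ∀ i ∉ E, (t.src i).length ≤ 1) (hdst : ∀ i ∉ E, (t.dst i).length ≤ 1) :
    ∃ t', unembedT E V t = some t' ∧ (VsE E V sender sent).IsConstrainedTrans t' ∧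
      t'.src = unembedS E V t.src ∧ t'.msg = t.msg ∧ t'.dst = unembedS E V t.dst ∧
      t'.out = t.out := by
  obtain ⟨⟨i, l⟩, σ, m, σ', o⟩ := t
  obtain ⟨htr, hb, -⟩ := ht
  simp only [VLSM.IsTrans, freeComp, comp, Prod.mk.injEq] at htr hb hsent hsrc hdst
  obtain ⟨rfl, rfl⟩ := htr
  have hphi : ∀ mm, m = some mm →
      sentMix E sent (sender mm) (unembedS E V σ (sender mm)) mm :=
    fun mm h => sentMix_unembedS V sent (hsrc _) (hsent mm h)
  by_cases h : i ∈ E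
  · refine ⟨⟨⟨i, cast (mixL_of_mem h).symm l⟩, unembedS E V σ, m, unembedS E V _, _⟩, ?_,
      ⟨?_, ?_, hphi⟩, rfl, rfl, rfl, rfl⟩
    · simp [unembedT, unembedL, h]
    · have := VLSM.tau_cast_of_heq (mixL_of_mem h) (mixS_of_mem h)
        (mixV_heq_of_mem V h) l (σ i) m
      simp only [VLSM.IsTrans, VsE, comp, unembedS_of_mem V σ h, this]
      rw [unembedS_update, unembedS_of_mem V _ h, Function.update_self]
    · simp only [unembedS_of_mem V σ h]
      exact (VLSM.beta_cast_of_heq (mixL_of_mem h) (mixS_of_mem h)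
        (mixV_heq_of_mem V h) l (σ i) m).2 hb
  · obtain ⟨l', s, rfl, hs, hbeta, htau⟩ := eVLSM_act_of_length_le_one (V i) hb
      (by simpa using hdst i h)
    refine ⟨⟨⟨i, cast (mixL_of_notMem h).symm l'⟩, unembedS E V σ, m, unembedS E V _, _⟩, ?_,
      ⟨?_, ?_, hphi⟩, rfl, rfl, rfl, rfl⟩
    · simp [unembedT, unembedL, h]
    · have := VLSM.tau_cast_of_heq (mixL_of_notMem h) (mixS_of_notMem h)
        (mixV_heq_of_notMem V h) l' s m
      simp only [VLSM.IsTrans, VsE, comp, unembedS_of_notMem V σ h, hs, List.headD_cons, this]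
      rw [hs] at htau
      rw [htau, unembedS_update, unembedS_of_notMem V _ h, Function.update_self]
      rfl
    · simp only [unembedS_of_notMem V σ h, hs, List.headD_cons]
      exact (VLSM.beta_cast_of_heq (mixL_of_notMem h) (mixS_of_notMem h)
        (mixV_heq_of_notMem V h) l' s m).2 hbeta

/-- A valid trace of the limited model maps to a valid trace of the fixed-set model for any
`E` containing all components with several copies in the final state.  Moreover each copy in
the final state has a history all of whose emitted messages are valid in that model. -/
theorem exists_mapM_unembedT_validTraceTo (V : ∀ i, VLSM (Lf i) (Sf i) M)
    (sender : M → Fin n) (sent : ∀ i, Sf i → M → Prop)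
    (hsent : ∀ i, IsSentOracle (V i) (sent i)) (w : Fin n → ℝ) (t : ℝ) (E : Finset (Fin n))
    (tr : List (VTrans (Σ i, ELabel (Lf i) (Sf i)) (∀ i, List (Sf i)) M))
    (γ : ∀ i, List (Sf i)) (h : (Vslim V sender sent w t).ValidTraceTo tr γ)
    (hE : ∀ i ∉ E, (γ i).length ≤ 1) :
    (∃ tr', tr.mapM (unembedT E V) = some tr' ∧
      (VsE E V sender sent).ValidTraceTo tr' (unembedS E V γ)) ∧
    ∀ i, ∀ s ∈ γ i, ∃ trs, (V i).ConstrainedTraceTo trs s ∧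
      ∀ m, EmittedOn trs m → (VsE E V sender sent).ValidOMsg (some m) := by
  induction tr using List.reverseRecOn generalizing γ with
  | nil =>
    obtain ⟨-, s0, h0, rfl⟩ := h
    refine ⟨⟨[], rfl, by simp, _, unembedS_mem_init V sender sent h0, rfl⟩, fun i s hs => ?_⟩
    obtain ⟨a, ha, he⟩ := h0 i
    obtain rfl : s = a := by simpa [he] using hs
    exact ⟨[], ⟨by simp, s, ha, rfl⟩, by simp [EmittedOn]⟩
  | append_singleton tr x ih =>
    obtain ⟨htr, hx, rfl⟩ := (VLSM.validTraceTo_append_singleton _ _ _ _).1 h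
    have hdst : x.dst = Function.update x.src x.lbl.1
        ((eVLSM (V x.lbl.1)).tau x.lbl.2 (x.src x.lbl.1) x.msg).1 :=
      (congrArg Prod.fst hx.1.1).symm
    have hout : x.out = ((eVLSM (V x.lbl.1)).tau x.lbl.2 (x.src x.lbl.1) x.msg).2 :=
      (congrArg Prod.snd hx.1.1).symm
    have hsrc : ∀ i ∉ E, (x.src i).length ≤ 1 := fun i hi => by
      refine le_trans ?_ (hE i hi)
      rw [hdst]
      by_cases hix : i = x.lbl.1
      · subst hix
        simpa using eVLSM_tau_length_le _ _ _ _
      · simp [hix]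
    obtain ⟨⟨tr', hmap, hval⟩, hhist⟩ := ih x.src htr hsrc
    obtain ⟨hb, hsnt, -⟩ := hx.1.2
    obtain ⟨x', hx', hcon, hs', hm', hd', ho'⟩ := exists_unembedT_eq_some V sender sent
      (t := x) ⟨hx.1.1, hb, trivial⟩ hsnt hsrc hE
    have hmsg : (VsE E V sender sent).ValidOMsg x.msg := by
      rcases hm : x.msg with _ | m
      · exact .none
      · obtain ⟨s, hs, hsm⟩ := hsnt m hm
        obtain ⟨trs, hc, he⟩ := hhist _ s hs
        exact he m ((hsent _ s ⟨trs, hc⟩ m).1 hsm trs hc)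
    have hxv : (VsE E V sender sent).IsValidTrans x' :=
      ⟨hcon, hs' ▸ hval.validState, hm' ▸ hmsg⟩
    refine ⟨⟨tr' ++ [x'], by simp [hmap, hx'],
      (VLSM.validTraceTo_append_singleton _ _ _ _).2 ⟨hs' ▸ hval, hxv, hd'⟩⟩,
      fun i s hs => ?_⟩
    rw [hdst] at hs
    by_cases hix : i = x.lbl.1
    · subst hix
      rw [Function.update_self] at hs
      rcases eVLSM_mem_tau _ hb hs with hs | hs | ⟨l', s', hs', hb', rfl, ho⟩
      · exact hhist _ s hs
      · exact ⟨[], ⟨by simp, s, hs, rfl⟩, by simp [EmittedOn]⟩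
      · obtain ⟨trs, hc, he⟩ := hhist _ s' hs'
        refine ⟨_, hc.append_singleton hb', ?_⟩
        rintro m ⟨y, hy, hym⟩
        rcases List.mem_append.1 hy with hy | hy
        · exact he m ⟨y, hy, hym⟩
        · obtain rfl := List.mem_singleton.1 hy
          change ((V _).tau l' s' x.msg).2 = some m at hym
          have := hxv.validOMsg_out
          rwa [ho', hout, ho, hym] at this
    · rw [Function.update_of_ne hix] at hs
      exact hhist i s hs

/-- Valid traces of the limited model end with equivocation weight below the threshold. -/
theorem sum_weight_lt_of_validTraceTo (V : ∀ i, VLSM (Lf i) (Sf i) M)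
    (sender : M → Fin n) (sent : ∀ i, Sf i → M → Prop) (w : Fin n → ℝ) {t : ℝ} (ht : 0 < t)
    {tr : List (VTrans (Σ i, ELabel (Lf i) (Sf i)) (∀ i, List (Sf i)) M)}
    {γ : ∀ i, List (Sf i)} (h : (Vslim V sender sent w t).ValidTraceTo tr γ) :
    (∑ i ∈ Finset.univ.filter fun i => 1 < (γ i).length, w i) < t := by
  induction tr using List.reverseRecOn with
  | nil =>
    obtain ⟨-, s0, h0, rfl⟩ := h
    rw [Finset.filter_false_of_mem]
    · simpa using ht
    · intro i _
      obtain ⟨a, -, he⟩ := h0 i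
      simp [he]
  | append_singleton tr x _ =>
    obtain ⟨-, hx, rfl⟩ := (VLSM.validTraceTo_append_singleton _ _ _ _).1 h
    have hdst : _ = x.dst := congrArg Prod.fst hx.1.1
    rw [← hdst]
    exact hx.1.2.2.2

end FixedSetModel

/-- Every valid trace of the t-limited state-equivocation model with final state `γ`
is, with `E` the set of components with more than one copy in `γ`, of weight below
the threshold, and maps (replacing each unequivocating component state by its unique
entry and each label `⟨1, l⟩` on such a component by `l`) to a valid trace of the
fixed-set state-equivocation model for `E`. -/
theorem equivocators_limited_valid_trace_is_fixed
    {n : ℕ} {Lf Sf : Fin n → Type} {M : Type}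
    (V : ∀ i, VLSM (Lf i) (Sf i) M) (sender : M → Fin n)
    (sent : ∀ i, Sf i → M → Prop) (hsent : ∀ i, IsSentOracle (V i) (sent i))
    (w : Fin n → ℝ) (hw : ∀ i, 0 < w i) (t : ℝ) (ht : 0 < t)
    (tr : List (VTrans (Σ i, ELabel (Lf i) (Sf i)) (∀ i, List (Sf i)) M))
    (γ : ∀ i, List (Sf i))
    (h : (Vslim V sender sent w t).ValidTraceTo tr γ)
    (E : Finset (Fin n)) (hE : E = Finset.univ.filter fun i => 1 < (γ i).length) :
    (∑ i ∈ E, w i) < t ∧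
      ∃ tr', tr.mapM (unembedT E V) = some tr' ∧
        (VsE E V sender sent).IsValidTrace tr' := by
  obtain ⟨⟨tr', hmap, hval⟩, -⟩ :=
    exists_mapM_unembedT_validTraceTo V sender sent hsent w t E tr γ h (by simp [hE])
  exact ⟨hE ▸ sum_weight_lt_of_validTraceTo V sender sent w ht h, tr', hmap, _, hval⟩
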